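/- Let n ≥ 2 be an integer, α ∈ ℝ, e ∈ S^{n−1} ⊂ ℝⁿ, and let Θ : S^{n−1} → ℝ be integrable with respect to σ. Define Θ̃(θ̃) = Θ(Φ_{α,e}^∞(θ̃))·(cosh(α) + sinh(α)·⟨e, θ̃⟩)^{−n}, and set m₀ = ∫_{S^{n−1}} Θ dσ, m_i = ∫_{S^{n−1}} Θ(θ)·θ_i dσ(θ) for i = 1, …, n, and ⟨e, m⃗⟩ = ∑_{j=1}^n e_j·m_j. Then for each i = 1, …, n: ∫_{S^{n−1}} Θ̃(θ̃)·θ̃_i dσ(θ̃) = (−sinh(α)·m₀ + cosh(α)·⟨e, m⃗⟩)·e_i + (m_i − ⟨e, m⃗⟩·e_i). Together with the transformation of m₀, this says that the energy-momentum covector transforms under the hyperbolic isometry by (m₀, m₁, …, m_n) = M_{α,e}·(m̃₀, m̃₁, …, m̃_n). -/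

import Mathlib

open scoped RealInnerProductSpace
open MeasureTheory

/-- The boundary action at infinity `Φ_{α,e}^∞` of the hyperbolic boost `M_{α,e}`
(Section 3.4). -/
noncomputable def PhiInf {n : ℕ} (α : ℝ) (e : EuclideanSpace ℝ (Fin n))
    (θ : EuclideanSpace ℝ (Fin n)) : EuclideanSpace ℝ (Fin n) :=
  (Real.cosh α + Real.sinh α * ⟪e, θ⟫)⁻¹ •
    ((Real.sinh α + Real.cosh α * ⟪e, θ⟫) • e + (θ - ⟪e, θ⟫ • e))

open scoped NNReal ENNReal

lemma conf_aux {E : Type*} [MetricSpace E] [MeasurableSpace E] [BorelSpace E]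
    (S : Set E) (hS : MeasurableSet S) (F G : E → E) (hG : Measurable G)
    (hFS : ∀ x ∈ S, F x ∈ S) (hGS : ∀ x ∈ S, G x ∈ S)
    (hGF : ∀ x ∈ S, G (F x) = x) (hFG : ∀ x ∈ S, F (G x) = x)
    (l : E → ℝ≥0) (hl : Measurable l) (hl0 : ∀ x ∈ S, 0 < l x)
    (hd : ∀ x ∈ S, ∀ y ∈ S, dist (F x) (F y) ^ 2 = l x * l y * dist x y ^ 2)
    (d : ℝ) (hd0 : 0 ≤ d) :
    ((μH[d]).restrict S).map G = ((μH[d]).restrict S).withDensity (fun x => (l x : ℝ≥0∞) ^ d) := by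
  set σ : Measure E := (μH[d]).restrict S with hσ
  have hlm : Measurable (fun x => (l x : ℝ≥0∞)) := hl.coe_nnreal_ennreal
  have hwm : Measurable (fun x => (l x : ℝ≥0∞) ^ d) := hlm.pow_const d
  -- piece estimates
  have hmap : ∀ B, MeasurableSet B → σ.map G B = μH[d] (F '' (S ∩ B)) := by
    intro B hB
    rw [Measure.map_apply hG hB, hσ, Measure.restrict_apply (hG hB)]
    congr 1
    ext x
    constructor
    · rintro ⟨h1, h2⟩
      exact ⟨G x, ⟨hGS x h2, h1⟩, hFG x h2⟩
    · rintro ⟨y, ⟨h1, h2⟩, rfl⟩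
      refine ⟨?_, hFS y h1⟩
      simpa [hGF y h1] using h2
  have hfin : ∀ t : ℝ≥0, 1 < t → ∀ A, MeasurableSet A →
      σ.map G A ≤ (t : ℝ≥0∞) ^ d * σ.withDensity (fun x => (l x : ℝ≥0∞) ^ d) A ∧
      σ.withDensity (fun x => (l x : ℝ≥0∞) ^ d) A ≤ (t : ℝ≥0∞) ^ d * σ.map G A := by
    intro t ht A hA
    have ht0 : 0 < t := lt_trans one_pos ht
    have piece : ∀ k : ℤ, 
        σ.map G (A ∩ (fun x => (l x : ℝ≥0∞)) ⁻¹' Set.Ico ((t : ℝ≥0∞) ^ k) ((t : ℝ≥0∞) ^ (k+1))) ≤ (t : ℝ≥0∞) ^ d * σ.withDensity (fun x => (l x : ℝ≥0∞) ^ d) (A ∩ (fun x => (l x : ℝ≥0∞)) ⁻¹' Set.Ico ((t : ℝ≥0∞) ^ k) ((t : ℝ≥0∞) ^ (k+1))) ∧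
      σ.withDensity (fun x => (l x : ℝ≥0∞) ^ d) (A ∩ (fun x => (l x : ℝ≥0∞)) ⁻¹' Set.Ico ((t : ℝ≥0∞) ^ k) ((t : ℝ≥0∞) ^ (k+1))) ≤ (t : ℝ≥0∞) ^ d * σ.map G (A ∩ (fun x => (l x : ℝ≥0∞)) ⁻¹' Set.Ico ((t : ℝ≥0∞) ^ k) ((t : ℝ≥0∞) ^ (k+1))) := by
      intro k
      set B := (A ∩ (fun x => (l x : ℝ≥0∞)) ⁻¹' Set.Ico ((t : ℝ≥0∞) ^ k) ((t : ℝ≥0∞) ^ (k+1))) with hBdef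
      have hB : MeasurableSet B := hA.inter (hlm measurableSet_Ico)
      set a : ℝ≥0 := t ^ k with ha
      have ha0 : 0 < a := zpow_pos ht0 k
      have hBl : ∀ x ∈ B, a ≤ l x ∧ l x ≤ t * a := by
        rintro x ⟨-, h1, h2⟩
        have e1 : ((t : ℝ≥0∞)) ^ k = ((t ^ k : ℝ≥0) : ℝ≥0∞) := by
          rw [ENNReal.coe_zpow ht0.ne']
        have e2 : ((t : ℝ≥0∞)) ^ (k+1) = ((t * t ^ k : ℝ≥0) : ℝ≥0∞) := by
          rw [← ENNReal.coe_zpow ht0.ne', zpow_add₀ ht0.ne', zpow_one, mul_comm]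
        rw [e1] at h1
        rw [e2] at h2
        exact ⟨ENNReal.coe_le_coe.1 h1, ENNReal.coe_le_coe.1 h2.le⟩
      have L1 : LipschitzOnWith (t * a) F (S ∩ B) := by
        refine LipschitzOnWith.of_dist_le_mul fun x hx y hy => ?_
        refine abs_le_of_sq_le_sq' ?_ (by positivity) |>.2
        rw [hd x hx.1 y hy.1, mul_pow]
        gcongr
        rw [pow_two]
        gcongr
        · exact_mod_cast (hBl x hx.2).2
        · exact_mod_cast (hBl y hy.2).2
      have L2 : LipschitzOnWith a⁻¹ G (F '' (S ∩ B)) := by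
        refine LipschitzOnWith.of_dist_le_mul ?_
        rintro _ ⟨x, hx, rfl⟩ _ ⟨y, hy, rfl⟩
        rw [hGF x hx.1, hGF y hy.1]
        refine abs_le_of_sq_le_sq' ?_ (by positivity) |>.2
        rw [mul_pow, hd x hx.1 y hy.1]
        have h1 : (a : ℝ) ≤ l x := by exact_mod_cast (hBl x hx.2).1
        have h2 : (a : ℝ) ≤ l y := by exact_mod_cast (hBl y hy.2).1
        have h3 : (0 : ℝ) < a := by exact_mod_cast ha0
        have h4 : (a : ℝ) ^ 2 ≤ l x * l y := by rw [pow_two]; gcongr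
        push_cast
        rw [inv_pow, ← mul_assoc, inv_mul_eq_div]
        refine le_mul_of_one_le_left (by positivity) ?_
        rwa [one_le_div (by positivity)]
      have M1 := L1.hausdorffMeasure_image_le hd0
      have M2 := L2.hausdorffMeasure_image_le hd0
      have hGim : G '' (F '' (S ∩ B)) = S ∩ B := by
        rw [Set.image_image]
        ext x
        constructor
        · rintro ⟨y, hy, rfl⟩
          simpa [hGF y hy.1] using hy
        · intro hx
          exact ⟨x, hx, hGF x hx.1⟩
      rw [hGim] at M2
      rw [← hmap B hB] at M1 M2
      have hσB : μH[d] (S ∩ B) = σ B := by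
        rw [hσ, Measure.restrict_apply hB, Set.inter_comm]
      rw [hσB] at M1 M2
      have D1 : (a : ℝ≥0∞) ^ d * σ B ≤ σ.withDensity (fun x => (l x : ℝ≥0∞) ^ d) B := by
        rw [withDensity_apply _ hB, ← setLIntegral_const]
        refine setLIntegral_mono' hB fun x hx => ?_
        gcongr
        exact (hBl x hx).1
      have D2 : σ.withDensity (fun x => (l x : ℝ≥0∞) ^ d) B ≤ ((t * a : ℝ≥0) : ℝ≥0∞) ^ d * σ B := by
        rw [withDensity_apply _ hB, ← setLIntegral_const]
        refine setLIntegral_mono' hB fun x hx => ?_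
        gcongr
        exact (hBl x hx).2
      have ta : ((t * a : ℝ≥0) : ℝ≥0∞) ^ d = (t : ℝ≥0∞) ^ d * (a : ℝ≥0∞) ^ d := by
        rw [ENNReal.coe_mul, ENNReal.mul_rpow_of_nonneg _ _ hd0]
      rw [ta, mul_assoc] at M1 D2
      refine ⟨M1.trans (by gcongr), D2.trans ?_⟩
      gcongr
      calc (a : ℝ≥0∞) ^ d * σ B ≤ (a : ℝ≥0∞) ^ d * (((a⁻¹ : ℝ≥0) : ℝ≥0∞) ^ d * σ.map G B) := by gcongr
        _ = σ.map G B := by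
          rw [← mul_assoc, ← ENNReal.mul_rpow_of_nonneg _ _ hd0, ← ENNReal.coe_mul,
            mul_inv_cancel₀ ha0.ne']
          simp
    have sums : ∀ ν : Measure E, ν Sᶜ = 0 → ν A = ∑' k : ℤ, ν (A ∩ (fun x => (l x : ℝ≥0∞)) ⁻¹' Set.Ico ((t : ℝ≥0∞) ^ k) ((t : ℝ≥0∞) ^ (k+1))) := by
      intro ν hν
      rw [measure_eq_measure_preimage_add_measure_tsum_Ico_zpow ν hlm hA ht]
      have z1 : ν (A ∩ (fun x => (l x : ℝ≥0∞)) ⁻¹' {0}) = 0 := by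
        refine measure_mono_null ?_ hν
        rintro x ⟨-, hx⟩ hxS
        have := hl0 x hxS
        simp at hx
        simp [hx] at this
      have z2 : (A ∩ (fun x => (l x : ℝ≥0∞)) ⁻¹' {∞}) = ∅ := by
        ext x; simp
      rw [z1, z2]; simp
    have hσS : σ Sᶜ = 0 := by
      rw [hσ, Measure.restrict_apply hS.compl]; simp
    have n1 : σ.map G Sᶜ = 0 := by
      rw [hmap _ hS.compl]; simp
    have n2 : σ.withDensity (fun x => (l x : ℝ≥0∞) ^ d) Sᶜ = 0 :=
      withDensity_absolutelyContinuous _ _ hσS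
    rw [sums _ n1, sums _ n2, ← ENNReal.tsum_mul_left, ← ENNReal.tsum_mul_left]
    exact ⟨ENNReal.tsum_le_tsum fun k => (piece k).1, ENNReal.tsum_le_tsum fun k => (piece k).2⟩
  have lim : ∀ p q : ℝ≥0∞, (∀ t : ℝ≥0, 1 < t → p ≤ (t : ℝ≥0∞) ^ d * q) → p ≤ q := by
    intro p q h
    have T : Filter.Tendsto (fun t : ℝ≥0 => (t : ℝ≥0∞) ^ d * q) (nhdsWithin 1 (Set.Ioi 1)) (nhds (((1 : ℝ≥0) : ℝ≥0∞) ^ d * q)) := by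
      refine ENNReal.Tendsto.mul_const ?_ (Or.inl (by simp))
      exact ((ENNReal.continuous_rpow_const.comp ENNReal.continuous_coe).tendsto 1).mono_left nhdsWithin_le_nhds
    simp only [ENNReal.coe_one, ENNReal.one_rpow, one_mul] at T
    refine ge_of_tendsto T ?_
    filter_upwards [self_mem_nhdsWithin] with t ht using h t ht
  ext A hA
  exact le_antisymm (lim _ _ fun t ht => (hfin t ht A hA).1) (lim _ _ fun t ht => (hfin t ht A hA).2)

lemma w_pos {n : ℕ} (α : ℝ) (e x : EuclideanSpace ℝ (Fin n)) (he : ‖e‖ = 1) (hx : ‖x‖ = 1) :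
    0 < Real.cosh α + Real.sinh α * ⟪e, x⟫ := by
  have h1 : |⟪e, x⟫| ≤ 1 := by
    have := abs_real_inner_le_norm e x
    rwa [he, hx, one_mul] at this
  have h2 : |Real.sinh α| < Real.cosh α := by
    refine abs_lt_of_sq_lt_sq ?_ (Real.cosh_pos α).le
    rw [Real.cosh_sq]; linarith
  have h3 : |Real.sinh α * ⟪e, x⟫| ≤ |Real.sinh α| := by
    rw [abs_mul]
    exact mul_le_of_le_one_right (abs_nonneg _) h1
  have := neg_abs_le (Real.sinh α * ⟪e, x⟫)
  linarith

lemma e_inner_phi {n : ℕ} (α : ℝ) (e x : EuclideanSpace ℝ (Fin n)) (he : ‖e‖ = 1) :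
    ⟪e, PhiInf α e x⟫ = (Real.cosh α + Real.sinh α * ⟪e, x⟫)⁻¹ *
      (Real.sinh α + Real.cosh α * ⟪e, x⟫) := by
  simp only [PhiInf, inner_smul_right, inner_add_right, inner_sub_right,
    real_inner_self_eq_norm_sq, he]
  ring

lemma inner_phi {n : ℕ} (α : ℝ) (e x y : EuclideanSpace ℝ (Fin n)) (he : ‖e‖ = 1) :
    ⟪PhiInf α e x, PhiInf α e y⟫ = (Real.cosh α + Real.sinh α * ⟪e, x⟫)⁻¹ *
      (Real.cosh α + Real.sinh α * ⟪e, y⟫)⁻¹ *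
      ((Real.sinh α + Real.cosh α * ⟪e, x⟫) * (Real.sinh α + Real.cosh α * ⟪e, y⟫)
        + ⟪x, y⟫ - ⟪e, x⟫ * ⟪e, y⟫) := by
  simp only [PhiInf, inner_smul_right, inner_add_right, inner_sub_right, inner_smul_left,
    inner_add_left, inner_sub_left, real_inner_self_eq_norm_sq, he, real_inner_comm e x,
    conj_trivial]
  ring

lemma phi_norm {n : ℕ} (α : ℝ) (e x : EuclideanSpace ℝ (Fin n)) (he : ‖e‖ = 1) (hx : ‖x‖ = 1) :
    ‖PhiInf α e x‖ = 1 := by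
  have hw := w_pos α e x he hx
  have hc := Real.cosh_sq α
  have h : ‖PhiInf α e x‖ ^ 2 = 1 := by
    rw [← real_inner_self_eq_norm_sq, inner_phi α e x x he, real_inner_self_eq_norm_sq, hx]
    field_simp
    linear_combination (⟪e, x⟫ ^ 2 - 1) * hc
  nlinarith [norm_nonneg (PhiInf α e x)]

lemma phi_dist {n : ℕ} (α : ℝ) (e x y : EuclideanSpace ℝ (Fin n)) (he : ‖e‖ = 1)
    (hx : ‖x‖ = 1) (hy : ‖y‖ = 1) :
    dist (PhiInf α e x) (PhiInf α e y) ^ 2 = (Real.cosh α + Real.sinh α * ⟪e, x⟫)⁻¹ *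
      (Real.cosh α + Real.sinh α * ⟪e, y⟫)⁻¹ * dist x y ^ 2 := by
  have hw := w_pos α e x he hx
  have hw2 := w_pos α e y he hy
  have hc := Real.cosh_sq α
  rw [dist_eq_norm, dist_eq_norm, norm_sub_sq_real, norm_sub_sq_real, phi_norm α e x he hx,
    phi_norm α e y he hy, hx, hy, inner_phi α e x y he]
  field_simp
  linear_combination (2 - 2 * ⟪e, x⟫ * ⟪e, y⟫) * hc

lemma w_phi {n : ℕ} (α : ℝ) (e x : EuclideanSpace ℝ (Fin n)) (he : ‖e‖ = 1) (hx : ‖x‖ = 1) :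
    Real.cosh α - Real.sinh α * ⟪e, PhiInf α e x⟫ =
      (Real.cosh α + Real.sinh α * ⟪e, x⟫)⁻¹ := by
  have hw := w_pos α e x he hx
  have hc := Real.cosh_sq α
  rw [e_inner_phi α e x he]
  field_simp
  linear_combination hc

lemma phi_phi {n : ℕ} (α : ℝ) (e x : EuclideanSpace ℝ (Fin n)) (he : ‖e‖ = 1) (hx : ‖x‖ = 1) :
    PhiInf (-α) e (PhiInf α e x) = x := by
  have hw := w_pos α e x he hx
  have hc := Real.cosh_sq α
  have h1 := w_phi α e x he hx
  have h2 := e_inner_phi α e x he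
  rw [PhiInf, Real.cosh_neg, Real.sinh_neg, neg_mul, ← sub_eq_add_neg, h1, inv_inv, h2]
  ext i
  simp only [PhiInf, PiLp.smul_apply, PiLp.add_apply, PiLp.sub_apply, smul_eq_mul]
  field_simp
  linear_combination (⟪e, x⟫ * e i) * hc

lemma phi_meas {n : ℕ} (α : ℝ) (e : EuclideanSpace ℝ (Fin n)) : Measurable (PhiInf α e) := by
  unfold PhiInf
  have h : Measurable (fun θ : EuclideanSpace ℝ (Fin n) => ⟪e, θ⟫) :=
    (continuous_const.inner continuous_id).measurable
  exact ((h.const_mul _).const_add _).inv.smul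
    ((((h.const_mul _).const_add _).smul_const e).add (measurable_id.sub (h.smul_const e)))

/-- Transformation of the momentum components of the energy-momentum covector
(Section 3.4): with `Θ̃(θ̃) = Θ(Φ_{α,e}^∞(θ̃)) (cosh α + sinh α ⟨e,θ̃⟩)^{−n}`,
`m₀ = ∫ Θ dσ`, `mᵢ = ∫ Θ(θ) θᵢ dσ(θ)`, and `⟨e,m⃗⟩ = ∑ⱼ eⱼ mⱼ`, one has, for each `i`,
`∫ Θ̃(θ̃) θ̃ᵢ dσ(θ̃) = (−sinh α · m₀ + cosh α · ⟨e,m⃗⟩) eᵢ + (mᵢ − ⟨e,m⃗⟩ eᵢ)`,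
where `σ` is the `(n−1)`-dimensional Hausdorff measure on the unit sphere. -/
theorem momentum_transform (n : ℕ) (hn : 2 ≤ n) (α : ℝ)
    (e : EuclideanSpace ℝ (Fin n)) (he : e ∈ Metric.sphere (0 : EuclideanSpace ℝ (Fin n)) 1)
    (Θ : EuclideanSpace ℝ (Fin n) → ℝ)
    (hΘ : IntegrableOn Θ (Metric.sphere (0 : EuclideanSpace ℝ (Fin n)) 1) (μH[(n:ℝ) - 1]))
    (Θt : EuclideanSpace ℝ (Fin n) → ℝ)
    (hΘt : ∀ θt, Θt θt =
      Θ (PhiInf α e θt) / (Real.cosh α + Real.sinh α * ⟪e, θt⟫) ^ n)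
    (m₀ : ℝ)
    (hm₀ : m₀ = ∫ θ in Metric.sphere (0 : EuclideanSpace ℝ (Fin n)) 1, Θ θ ∂(μH[(n:ℝ) - 1]))
    (m : Fin n → ℝ)
    (hm : ∀ i, m i =
      ∫ θ in Metric.sphere (0 : EuclideanSpace ℝ (Fin n)) 1, Θ θ * θ i ∂(μH[(n:ℝ) - 1]))
    (em : ℝ) (hem : em = ∑ j, e j * m j) :
    ∀ i : Fin n,
      ∫ θt in Metric.sphere (0 : EuclideanSpace ℝ (Fin n)) 1, Θt θt * θt i
          ∂(μH[(n:ℝ) - 1]) =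
        (-Real.sinh α * m₀ + Real.cosh α * em) * e i + (m i - em * e i) := by
  intro i
  have he1 : ‖e‖ = 1 := by simpa using he
  set S := Metric.sphere (0 : EuclideanSpace ℝ (Fin n)) 1 with hSdef
  have hS : MeasurableSet S := Metric.isClosed_sphere.measurableSet
  have hS1 : ∀ x, x ∈ S ↔ ‖x‖ = 1 := by intro x; simp [hSdef]
  set w : EuclideanSpace ℝ (Fin n) → ℝ := fun x => Real.cosh α - Real.sinh α * ⟪e, x⟫ with hw
  have hcw : Continuous w := by
    exact continuous_const.sub (continuous_const.mul (continuous_const.inner continuous_id))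
  have hw0 : ∀ x ∈ S, 0 < w x := by
    intro x hx
    have := w_pos (-α) e x he1 ((hS1 x).1 hx)
    rw [Real.cosh_neg, Real.sinh_neg] at this
    simp only [hw]; linarith
  have hd0 : (0 : ℝ) ≤ (n : ℝ) - 1 := by
    have : (2 : ℝ) ≤ n := by exact_mod_cast hn
    linarith
  have key := conf_aux S hS (PhiInf (-α) e) (PhiInf α e) (phi_meas α e)
    (fun x hx => (hS1 _).2 (phi_norm _ e x he1 ((hS1 x).1 hx)))
    (fun x hx => (hS1 _).2 (phi_norm _ e x he1 ((hS1 x).1 hx)))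
    (fun x hx => by simpa using phi_phi (-α) e x he1 ((hS1 x).1 hx))
    (fun x hx => phi_phi α e x he1 ((hS1 x).1 hx))
    (fun x => ((w x)⁻¹).toNNReal) hcw.measurable.inv.real_toNNReal
    (fun x hx => Real.toNNReal_pos.2 (inv_pos.2 (hw0 x hx)))
    (fun x hx y hy => by
      rw [Real.coe_toNNReal _ (inv_pos.2 (hw0 x hx)).le,
        Real.coe_toNNReal _ (inv_pos.2 (hw0 y hy)).le,
        phi_dist (-α) e x y he1 ((hS1 x).1 hx) ((hS1 y).1 hy)]
      simp only [hw, Real.cosh_neg, Real.sinh_neg, neg_mul, ← sub_eq_add_neg])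
    ((n : ℝ) - 1) hd0
  set σ := (μH[(n:ℝ) - 1] : Measure (EuclideanSpace ℝ (Fin n))).restrict S with hσ
  obtain ⟨k, rfl⟩ : ∃ k, n = k + 1 := ⟨n - 1, by omega⟩
  have hdens : (fun x => (((w x)⁻¹).toNNReal : ℝ≥0∞) ^ (((k + 1 : ℕ) : ℝ) - 1)) =
      fun x => (((((w x)⁻¹).toNNReal) ^ k : ℝ≥0) : ℝ≥0∞) := by
    ext x
    rw [show (((k + 1 : ℕ) : ℝ) - 1) = (k : ℝ) by push_cast; ring, ENNReal.rpow_natCast,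
      ENNReal.coe_pow]
  rw [hdens] at key
  -- the linear expression
  set L : EuclideanSpace ℝ (Fin (k + 1)) → ℝ := fun x =>
    (-Real.sinh α + Real.cosh α * ⟪e, x⟫) * e i + (x i - ⟪e, x⟫ * e i) with hL
  have hLc : Continuous L := by
    have h : Continuous (fun θ : EuclideanSpace ℝ (Fin (k + 1)) => ⟪e, θ⟫) :=
      continuous_const.inner continuous_id
    have h' : Continuous (fun θ : EuclideanSpace ℝ (Fin (k + 1)) => θ i) := by fun_prop
    simp only [hL]
    fun_prop
  set g : EuclideanSpace ℝ (Fin (k + 1)) → ℝ := fun x => Θ x * (w x ^ k * L x) with hg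
  have hgm : AEStronglyMeasurable g σ :=
    hΘ.aestronglyMeasurable.mul ((hcw.pow k).mul hLc).aestronglyMeasurable
  have hgm' : AEStronglyMeasurable g (σ.map (PhiInf α e)) := by
    rw [key]
    exact hgm.mono_ac (withDensity_absolutelyContinuous _ _)
  have hLphi : ∀ x ∈ S, L (PhiInf α e x) = (Real.cosh α + Real.sinh α * ⟪e, x⟫)⁻¹ * x i := by
    intro x hx
    have hx1 := (hS1 x).1 hx
    have hp := w_pos α e x he1 hx1
    have hc := Real.cosh_sq α
    simp only [hL]
    rw [e_inner_phi α e x he1]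
    simp only [PhiInf, PiLp.smul_apply, PiLp.add_apply, PiLp.sub_apply, smul_eq_mul]
    field_simp
    linear_combination (⟪e, x⟫ * e i) * hc
  have E1 : ∫ x, Θt x * x i ∂σ = ∫ x, g (PhiInf α e x) ∂σ := by
    refine setIntegral_congr_fun hS fun x hx => ?_
    have hx1 := (hS1 x).1 hx
    have hp := w_pos α e x he1 hx1
    have h1 : w (PhiInf α e x) = _ := w_phi α e x he1 hx1
    simp only [hg]
    rw [hLphi x hx, h1, hΘt, pow_succ, inv_pow]
    field_simp
  have E2 : ∫ x, g (PhiInf α e x) ∂σ = ∫ x, Θ x * L x ∂σ := by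
    have hwk : Measurable (fun x => ((w x)⁻¹).toNNReal ^ k) :=
      hcw.measurable.inv.real_toNNReal.pow_const k
    rw [← integral_map (phi_meas α e).aemeasurable hgm', key,
      integral_withDensity_eq_integral_smul hwk]
    refine setIntegral_congr_fun hS fun x hx => ?_
    have hp := hw0 x hx
    simp only [hg, NNReal.smul_def, NNReal.coe_pow, Real.coe_toNNReal _ (inv_pos.2 hp).le,
      smul_eq_mul, inv_pow]
    field_simp
  have hint : ∀ j, Integrable (fun x => Θ x * x j) σ := by
    intro j
    refine hΘ.mul_bdd (c := 1) ?_ ?_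
    · have h' : Continuous (fun θ : EuclideanSpace ℝ (Fin (k + 1)) => θ j) := by fun_prop
      exact h'.aestronglyMeasurable
    · refine (ae_restrict_mem hS).mono fun x hx => ?_
      exact ((hS1 x).1 hx) ▸ PiLp.norm_apply_le x j
  have hsum : Integrable (fun x => ∑ j, e j * (Θ x * x j)) σ :=
    integrable_finsetSum _ fun j _ => (hint j).const_mul _
  have hems : em = ∫ x, ∑ j, e j * (Θ x * x j) ∂σ := by
    rw [integral_finsetSum _ fun j _ => (hint j).const_mul _, hem]
    refine Finset.sum_congr rfl fun j _ => ?_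
    rw [integral_const_mul, hm]
  have hΘL : ∀ x, Θ x * L x = (-Real.sinh α * e i) * Θ x +
      ((Real.cosh α * e i - e i) * (∑ j, e j * (Θ x * x j)) + Θ x * x i) := by
    intro x
    have : ∑ j, e j * (Θ x * x j) = Θ x * ⟪e, x⟫ := by
      rw [PiLp.inner_apply, Finset.mul_sum]
      refine Finset.sum_congr rfl fun j _ => ?_
      simp
      ring
    rw [this]
    simp only [hL]
    ring
  rw [E1, E2]
  simp_rw [hΘL]
  have hΘ' : Integrable Θ σ := hΘ
  have hI : Integrable (fun x => (Real.cosh α * e i - e i) * (∑ j, e j * (Θ x * x j))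
      + Θ x * x i) σ := (hsum.const_mul _).add (hint i)
  rw [integral_add (hΘ'.const_mul _) hI,
    integral_add (hsum.const_mul _) (hint i), integral_const_mul, integral_const_mul, ← hems,
    ← hm₀, ← hm]
  ring
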